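/- For every probabilistic pushdown automaton Δ = (Q, Γ, Σ, ↪) there exists a nondeterministic pushdown automaton Δ' = (Q, Γ', Σ', ↪') with Γ ⊆ Γ' and Σ ⊆ Σ', such that for all n ∈ ℕ and all configurations qXγ and rYδ of Δ (with X, Y ∈ Γ): qXγ ∼ₙ rYδ in S(Δ) if and only if qXγ ∼_{3n} rYδ in S(Δ'), where ∼ₙ denotes the n-th bisimulation approximant of the respective induced pLTS. -/

import Mathlib

open scoped ENNReal

noncomputable section

/-- A probabilistic labelled transition system (pLTS): states `S`, alphabet `A`,
and a transition relation into probability distributions (`PMF`s) on `S`. -/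
structure PLTS (S : Type) (A : Type) where
  Tr : S → A → PMF S → Prop

namespace PLTS

variable {S A : Type}

/-- The mass that a distribution assigns to a set of states. -/
def mass (d : PMF S) (E : Set S) : ℝ≥0∞ := ∑' s : E, d s

/-- Two distributions are `r`-equivalent if they assign equal mass to every
`r`-equivalence class (for an equivalence `r`, the classes are the sets `{t | r s t}`). -/
def REquiv (r : S → S → Prop) (d d' : PMF S) : Prop :=
  ∀ s : S, mass d {t | r s t} = mass d' {t | r s t}

/-- An equivalence relation is a bisimulation if related states can match
each other's transitions with `r`-equivalent target distributions. -/
def IsBisimulation (L : PLTS S A) (r : S → S → Prop) : Prop :=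
  Equivalence r ∧
    ∀ s t, r s t → ∀ a d, L.Tr s a d → ∃ d', L.Tr t a d' ∧ REquiv r d d'

/-- Bisimilarity: the union of all bisimulation relations. -/
def Bisim (L : PLTS S A) (s t : S) : Prop :=
  ∃ r, L.IsBisimulation r ∧ r s t

/-- The bisimulation approximants `∼ₙ`. -/
def approx (L : PLTS S A) : ℕ → S → S → Prop
  | 0 => fun _ _ => True
  | n + 1 => fun s t =>
      (∀ a d, L.Tr s a d → ∃ d', L.Tr t a d' ∧ REquiv (L.approx n) d d') ∧
      (∀ a d', L.Tr t a d' → ∃ d, L.Tr s a d ∧ REquiv (L.approx n) d d')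

/-- A pLTS is finitely branching if every state has finitely many transitions. -/
def FinBranching (L : PLTS S A) : Prop :=
  ∀ s, {p : A × PMF S | L.Tr s p.1 p.2}.Finite

/-- One-step successor relation: `s → s'` iff some transition of `s` gives `s'`
positive probability. -/
def Step (L : PLTS S A) (s s' : S) : Prop :=
  ∃ a d, L.Tr s a d ∧ d s' ≠ 0

end PLTS

/-- The rules of a probabilistic pushdown automaton (pPDA) with control states
`Q`, stack alphabet `Γ`, input alphabet `A`: a rule `qX –a↪ d` is a tuple
`(q, X, a, d)` where `d` is a distribution over pairs of a control state and
a string of length at most two that replaces the top symbol. -/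
def PPDARules (Q Γ A : Type) := Q → Γ → A → PMF (Q × List Γ) → Prop

/-- Well-formedness of pPDA rules: target distributions are supported on
configurations `(p, α)` with `|α| ≤ 2` (i.e. `α ∈ Γ^{≤2}`). -/
def PPDAWf {Q Γ A : Type} (Δ : PPDARules Q Γ A) : Prop :=
  ∀ q X a d, Δ q X a d → ∀ p (α : List Γ), d (p, α) ≠ 0 → α.length ≤ 2

/-- A nondeterministic PDA is a pPDA all of whose rules use Dirac distributions. -/
def IsPDA {Q Γ A : Type} (Δ : PPDARules Q Γ A) : Prop :=
  ∀ q X a d, Δ q X a d → ∃ c, d = PMF.pure c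

/-- The pLTS induced by a pPDA on configurations `Q × Γ*`: a rule `qX –a↪ d`
and a tail `β ∈ Γ*` induce the transition `qXβ –a→ d'` with `d'(pαβ) = d(pα)`;
configurations with empty stack have no transitions. -/
def PPDARules.plts {Q Γ A : Type} (Δ : PPDARules Q Γ A) : PLTS (Q × List Γ) A where
  Tr := fun c a d' => ∃ (q : Q) (X : Γ) (β : List Γ) (d : PMF (Q × List Γ)),
    c = (q, X :: β) ∧ Δ q X a d ∧ d' = d.map (fun pα => (pα.1, pα.2 ++ β))

namespace PLTS

variable {S A : Type}

theorem approx_equivalence (L : PLTS S A) (n : ℕ) : Equivalence (L.approx n) := by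
  induction n with
  | zero => exact ⟨fun _ => trivial, fun _ => trivial, fun _ _ => trivial⟩
  | succ n _ =>
    refine ⟨fun s => ⟨fun a d h => ⟨d, h, fun _ => rfl⟩, fun a d h => ⟨d, h, fun _ => rfl⟩⟩,
      fun {s t} h => ⟨fun a d hd => ?_, fun a d hd => ?_⟩,
      fun {s t u} h h' => ⟨fun a d hd => ?_, fun a d hd => ?_⟩⟩
    · obtain ⟨d', h1, h2⟩ := h.2 a d hd
      exact ⟨d', h1, fun x => (h2 x).symm⟩
    · obtain ⟨d', h1, h2⟩ := h.1 a d hd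
      exact ⟨d', h1, fun x => (h2 x).symm⟩
    · obtain ⟨d', h1, h2⟩ := h.1 a d hd
      obtain ⟨d'', h3, h4⟩ := h'.1 a d' h1
      exact ⟨d'', h3, fun x => (h2 x).trans (h4 x)⟩
    · obtain ⟨d', h1, h2⟩ := h'.2 a d hd
      obtain ⟨d'', h3, h4⟩ := h.2 a d' h1
      exact ⟨d'', h3, fun x => (h4 x).trans (h2 x)⟩

/-- The setoid of the `n`-th approximant. -/
def approxSetoid (L : PLTS S A) (n : ℕ) : Setoid S := ⟨L.approx n, L.approx_equivalence n⟩

/-- The class of a state modulo the `n`-th approximant. -/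
def approxClass (L : PLTS S A) (n : ℕ) (s : S) : Quotient (L.approxSetoid n) :=
  Quotient.mk _ s

theorem approxClass_eq_iff (L : PLTS S A) (n : ℕ) (s t : S) :
    L.approxClass n s = L.approxClass n t ↔ L.approx n s t :=
  Quotient.eq (r := L.approxSetoid n)

theorem mass_class_eq_map_apply (L : PLTS S A) (n : ℕ) (d : PMF S) (s : S) :
    mass d {t | L.approx n s t} = d.map (L.approxClass n) (L.approxClass n s) := by
  classical
  rw [mass, tsum_subtype, PMF.map_apply]
  refine tsum_congr fun t => ?_
  simp only [Set.indicator_apply, Set.mem_ofPred_eq, approxClass_eq_iff]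

theorem rEquiv_approx_iff (L : PLTS S A) (n : ℕ) (d d' : PMF S) :
    REquiv (L.approx n) d d' ↔ d.map (L.approxClass n) = d'.map (L.approxClass n) := by
  constructor
  · intro h
    ext v
    obtain ⟨s, rfl⟩ := Quotient.exists_rep v
    have := h s
    rwa [mass_class_eq_map_apply, mass_class_eq_map_apply] at this
  · intro h s
    rw [mass_class_eq_map_apply, mass_class_eq_map_apply, h]

theorem pure_injective : Function.Injective (PMF.pure : S → PMF S) := by
  intro s t h
  have : s ∈ (PMF.pure t).support := by rw [← h]; simp
  simpa using this

theorem rEquiv_approx_pure_iff (L : PLTS S A) (n : ℕ) (s t : S) :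
    REquiv (L.approx n) (PMF.pure s) (PMF.pure t) ↔ L.approx n s t := by
  rw [rEquiv_approx_iff, PMF.pure_map, PMF.pure_map, pure_injective.eq_iff, approxClass_eq_iff]

/-- One direction of the matching condition of the `(n+1)`-st approximant. -/
def Matches (L : PLTS S A) (n : ℕ) (s t : S) : Prop :=
  ∀ a d, L.Tr s a d → ∃ d', L.Tr t a d' ∧ REquiv (L.approx n) d d'

theorem approx_succ_iff (L : PLTS S A) (n : ℕ) (s t : S) :
    L.approx (n + 1) s t ↔ L.Matches n s t ∧ L.Matches n t s := by
  refine and_congr Iff.rfl (forall₃_congr fun a d _ => exists_congr fun d' => ?_)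
  exact and_congr Iff.rfl ⟨fun h x => (h x).symm, fun h x => (h x).symm⟩

end PLTS

namespace PMF

theorem map_congr_support {α β : Type} (p : PMF α) {f g : α → β}
    (h : ∀ a, p a ≠ 0 → f a = g a) : p.map f = p.map g := by
  classical
  ext b
  rw [map_apply, map_apply]
  refine tsum_congr fun a => ?_
  by_cases ha : p a = 0
  · simp [ha]
  · rw [h a ha]

/-- Disintegration of a discrete distribution on a product along the first projection. -/
theorem exists_disintegration {V K : Type} (ν : PMF (V × K)) :
    ∃ κ : V → PMF K, ν = (ν.map Prod.fst).bind fun v => (κ v).map (Prod.mk v) := by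
  classical
  obtain ⟨⟨-, k₀⟩, -⟩ := ν.support_nonempty
  have fst_apply (v : V) : ν.map Prod.fst v = ∑' k, ν (v, k) := by
    rw [map_apply]
    refine (ENNReal.tsum_prod (f := fun v' k => if v = v' then ν (v', k) else 0)).trans ?_
    rw [tsum_eq_single v]
    · simp
    · intro v' hv
      simp [hv.symm]
  have mk_apply (p : PMF K) (v v' : V) (k : K) :
      p.map (Prod.mk v) (v', k) = if v' = v then p k else 0 := by
    rw [map_apply, tsum_eq_single k]
    · simp
    · intro k' hk
      simp [hk.symm]
  have hfin (v : V) : ∑' k, ν (v, k) ≠ ⊤ := by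
    rw [← fst_apply]; exact apply_ne_top _ _
  refine ⟨fun v => if h : ∑' k, ν (v, k) = 0 then pure k₀ else
    normalize (fun k => ν (v, k)) h (hfin v), ?_⟩
  ext ⟨v, k⟩
  rw [bind_apply, tsum_eq_single v]
  · rw [mk_apply, if_pos rfl, fst_apply]
    dsimp only
    split_ifs with h
    · rw [h, zero_mul]
      exact ENNReal.tsum_eq_zero.1 h k
    · rw [normalize_apply, mul_comm, mul_assoc, ENNReal.inv_mul_cancel h (hfin v), mul_one]
  · intro v' hv
    rw [mk_apply, if_neg hv.symm, mul_zero]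

/-- A coupling of `d` with labels in `K` transfers to any distribution with the same
image as `d`. -/
theorem exists_transfer {C C' V K : Type} (w : PMF (C × K)) (e : PMF C') (u : C → V)
    (u' : C' → V) (h : (w.map Prod.fst).map u = e.map u') :
    ∃ w' : PMF (C' × K), w'.map Prod.fst = e ∧
      w.map (Prod.map u id) = w'.map (Prod.map u' id) := by
  obtain ⟨κ, hκ⟩ := exists_disintegration (w.map (Prod.map u id))
  refine ⟨e.bind fun c => (κ (u' c)).map (Prod.mk c), ?_, ?_⟩
  · rw [map_bind]
    simp only [map_comp]
    have (c : C') : (κ (u' c)).map (Prod.fst ∘ Prod.mk c) = pure c := map_const _ c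
    simp only [this, bind_pure]
  · have hm : (w.map (Prod.map u id)).map Prod.fst = e.map u' := by
      rw [← h, map_comp, map_comp]
      rfl
    rw [hκ, hm, bind_map, map_bind]
    congr 1
    funext c
    rw [map_comp]
    rfl

theorem exists_of_map_eq {C C' V : Type} {w : PMF C} {w' : PMF C'} {u : C → V} {u' : C' → V}
    (h : w.map u = w'.map u') {c : C} (hc : w c ≠ 0) : ∃ c', w' c' ≠ 0 ∧ u' c' = u c := by
  have : u c ∈ (w'.map u').support := by
    rw [← h, support_map]
    exact ⟨c, hc, rfl⟩
  rw [support_map] at this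
  exact this

end PMF

namespace PPDARules

variable {Q Γ A : Type}

/-- Configurations that may occur on the right-hand side of a rule. -/
abbrev ShortConf (Q Γ : Type) : Type := {c : Q × List Γ // c.2.length ≤ 2}

instance [Finite Q] [Finite Γ] : Finite (ShortConf Q Γ) := by
  have h : {c : Q × List Γ | c.2.length ≤ 2}.Finite :=
    (Set.finite_univ.prod (List.finite_length_le Γ 2)).subset fun c hc => ⟨trivial, hc⟩
  exact h

/-- A labelling relation: which right-hand sides carry which labels. -/
abbrev Labelling (Q Γ : Type) : Type := Set (ShortConf Q Γ × ShortConf Q Γ)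

/-- A finite abstraction of a distribution on labels: which rules, combined with
which labelling relations, can induce it. -/
abbrev LabelType (Q Γ A : Type) : Type := Set (Q × Γ × A × Labelling Q Γ)

/-- A finite abstraction of a rule distribution. -/
abbrev DistType (Q Γ A : Type) : Type := Set (Labelling Q Γ × LabelType Q Γ A)

/-- The stack alphabet of the simulating PDA. -/
abbrev StackSym (Q Γ A : Type) : Type := Γ ⊕ DistType Q Γ A ⊕ Labelling Q Γ

/-- The input alphabet of the simulating PDA. -/
abbrev InputSym (Q Γ A : Type) : Type := A ⊕ LabelType Q Γ A ⊕ ShortConf Q Γ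

/-- The support of a coupling of right-hand sides and labels. -/
def labelling (w : PMF ((Q × List Γ) × ShortConf Q Γ)) : Labelling Q Γ :=
  {p | w (p.1.1, p.2) ≠ 0}

/-- The abstraction of a distribution on labels. -/
def labelType (Δ : PPDARules Q Γ A) (μ : PMF (ShortConf Q Γ)) : LabelType Q Γ A :=
  {x | ∃ w, Δ x.1 x.2.1 x.2.2.1 (w.map Prod.fst) ∧ labelling w = x.2.2.2 ∧ w.map Prod.snd = μ}

/-- The abstraction of a rule distribution. -/
def distType (Δ : PPDARules Q Γ A) (e : PMF (Q × List Γ)) : DistType Q Γ A :=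
  {x | ∃ w, w.map Prod.fst = e ∧ labelling w = x.1 ∧ Δ.labelType (w.map Prod.snd) = x.2}

/-- The rules of the simulating PDA: it chooses a rule of `Δ`, then a labelling of the
outcomes together with the type of the induced distribution on labels, and finally an outcome
carrying a given label. -/
inductive Simulation (Δ : PPDARules Q Γ A) : PPDARules Q (StackSym Q Γ A) (InputSym Q Γ A)
  | choose {q X a e} (h : Δ q X a e) :
      Simulation Δ q (.inl X) (.inl a) (PMF.pure (q, [.inr (.inl (Δ.distType e))]))
  | label {q} {σ : DistType Q Γ A} {S : Labelling Q Γ} {τ : LabelType Q Γ A} (h : (S, τ) ∈ σ) :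
      Simulation Δ q (.inr (.inl σ)) (.inr (.inl τ)) (PMF.pure (q, [.inr (.inr S)]))
  | outcome {q} {S : Labelling Q Γ} {z i : ShortConf Q Γ} (h : (z, i) ∈ S) :
      Simulation Δ q (.inr (.inr S)) (.inr (.inr i)) (PMF.pure (z.1.1, z.1.2.map .inl))

theorem isPDA_simulation (Δ : PPDARules Q Γ A) : IsPDA Δ.Simulation := by
  rintro q X a d (h | h | h) <;> exact ⟨_, rfl⟩

theorem wf_simulation (Δ : PPDARules Q Γ A) : PPDAWf Δ.Simulation := by
  rintro q X a d h p α hα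
  cases h with
  | choose h =>
    obtain ⟨-, rfl⟩ := Prod.ext_iff.1 ((PMF.mem_support_pure_iff _ _).1 hα)
    simp
  | label h =>
    obtain ⟨-, rfl⟩ := Prod.ext_iff.1 ((PMF.mem_support_pure_iff _ _).1 hα)
    simp
  | @outcome _ S z i h =>
    obtain ⟨-, rfl⟩ := Prod.ext_iff.1 ((PMF.mem_support_pure_iff _ _).1 hα)
    simpa using z.2

/-- Append a string to the bottom of the stack of a configuration. -/
def app (β : List Γ) (c : Q × List Γ) : Q × List Γ := (c.1, c.2 ++ β)

/-- The embedding of configurations of `Δ` into those of the simulating PDA. -/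
def embed (A : Type) (c : Q × List Γ) : Q × List (StackSym Q Γ A) := (c.1, c.2.map .inl)

theorem plts_tr_cons {Δ : PPDARules Q Γ A} {q : Q} {X : Γ} {β : List Γ} {a : A}
    {d : PMF (Q × List Γ)} :
    Δ.plts.Tr (q, X :: β) a d ↔ ∃ e, Δ q X a e ∧ d = e.map (app β) := by
  constructor
  · rintro ⟨q, X, β, e, h, he, rfl⟩
    obtain ⟨rfl, h⟩ := Prod.ext_iff.1 h
    obtain ⟨rfl, rfl⟩ := List.cons.inj h
    exact ⟨e, he, rfl⟩
  · rintro ⟨e, he, rfl⟩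
    exact ⟨q, X, β, e, rfl, he, rfl⟩

theorem plts_tr_nil {Δ : PPDARules Q Γ A} {q : Q} {a : A} {d : PMF (Q × List Γ)} :
    ¬ Δ.plts.Tr (q, []) a d := by
  rintro ⟨q, X, β, e, h, -⟩
  exact List.cons_ne_nil _ _ (Prod.ext_iff.1 h).2.symm

variable (Δ : PPDARules Q Γ A)

theorem simulation_tr_conf {q : Q} {X : Γ} {ρ : List (StackSym Q Γ A)} {a : InputSym Q Γ A}
    {d : PMF (Q × List (StackSym Q Γ A))} :
    Δ.Simulation.plts.Tr (q, .inl X :: ρ) a d ↔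
      ∃ b e, a = .inl b ∧ Δ q X b e ∧ d = PMF.pure (q, .inr (.inl (Δ.distType e)) :: ρ) := by
  rw [plts_tr_cons]
  constructor
  · rintro ⟨_, hs, rfl⟩
    cases hs with
    | choose h => exact ⟨_, _, rfl, h, PMF.pure_map _ _⟩
  · rintro ⟨b, e, rfl, h, rfl⟩
    exact ⟨_, .choose h, by rw [PMF.pure_map]; rfl⟩

theorem simulation_tr_distType {q : Q} {σ : DistType Q Γ A} {ρ : List (StackSym Q Γ A)}
    {a : InputSym Q Γ A} {d : PMF (Q × List (StackSym Q Γ A))} :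
    Δ.Simulation.plts.Tr (q, .inr (.inl σ) :: ρ) a d ↔
      ∃ S τ, a = .inr (.inl τ) ∧ (S, τ) ∈ σ ∧ d = PMF.pure (q, .inr (.inr S) :: ρ) := by
  rw [plts_tr_cons]
  constructor
  · rintro ⟨_, hs, rfl⟩
    cases hs with
    | label h => exact ⟨_, _, rfl, h, PMF.pure_map _ _⟩
  · rintro ⟨S, τ, rfl, h, rfl⟩
    exact ⟨_, .label h, by rw [PMF.pure_map]; rfl⟩

theorem simulation_tr_labelling {q : Q} {S : Labelling Q Γ} {β : List Γ}
    {a : InputSym Q Γ A} {d : PMF (Q × List (StackSym Q Γ A))} :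
    Δ.Simulation.plts.Tr (q, .inr (.inr S) :: β.map .inl) a d ↔
      ∃ z i, a = .inr (.inr i) ∧ (z, i) ∈ S ∧ d = PMF.pure (embed A (app β z.1)) := by
  have hz (z : ShortConf Q Γ) : PMF.pure (embed A (app β z.1)) =
      (PMF.pure (z.1.1, z.1.2.map .inl)).map (app (β.map .inl)) := by
    rw [PMF.pure_map]
    simp [embed, app]
  rw [plts_tr_cons]
  constructor
  · rintro ⟨_, hs, rfl⟩
    cases hs with
    | @outcome _ _ z i h => exact ⟨z, i, rfl, h, (hz z).symm⟩
  · rintro ⟨z, i, rfl, h, rfl⟩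
    exact ⟨_, .outcome h, hz z⟩

variable {Δ}

theorem simulation_matches_labelling_iff {n m : ℕ}
    (ih : ∀ c c', Δ.plts.approx n c c' ↔ Δ.Simulation.plts.approx m (embed A c) (embed A c'))
    (q r : Q) (S S' : Labelling Q Γ) (β δ : List Γ) :
    Δ.Simulation.plts.Matches m (q, .inr (.inr S) :: β.map .inl)
        (r, .inr (.inr S') :: δ.map .inl) ↔
      ∀ z i, (z, i) ∈ S → ∃ z', (z', i) ∈ S' ∧
        Δ.plts.approx n (app β z.1) (app δ z'.1) := by
  simp only [PLTS.Matches, simulation_tr_labelling]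
  constructor
  · intro h z i hz
    obtain ⟨-, ⟨z', i', hi, hz', rfl⟩, hr⟩ := h _ _ ⟨z, i, rfl, hz, rfl⟩
    obtain rfl : i = i' := by simpa using hi
    exact ⟨z', hz', (ih _ _).2 ((PLTS.rEquiv_approx_pure_iff _ _ _ _).1 hr)⟩
  · rintro h _ _ ⟨z, i, rfl, hz, rfl⟩
    obtain ⟨z', hz', hr⟩ := h z i hz
    exact ⟨_, ⟨z', i, rfl, hz', rfl⟩, (PLTS.rEquiv_approx_pure_iff _ _ _ _).2 ((ih _ _).1 hr)⟩

/-- Distributions that are supported on right-hand sides of rules. -/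
def IsShort (e : PMF (Q × List Γ)) : Prop := ∀ c, e c ≠ 0 → c.2.length ≤ 2

theorem fst_short {w : PMF ((Q × List Γ) × ShortConf Q Γ)} (h : IsShort (w.map Prod.fst))
    {c : Q × List Γ} {i : ShortConf Q Γ} (hc : w (c, i) ≠ 0) : c.2.length ≤ 2 := by
  refine h c ?_
  have : c ∈ (w.map Prod.fst).support := by
    rw [PMF.support_map]
    exact ⟨(c, i), hc, rfl⟩
  exact this

theorem labelling_transfer {V : Type} {w w' : PMF ((Q × List Γ) × ShortConf Q Γ)}
    {u u' : Q × List Γ → V} (hw' : IsShort (w'.map Prod.fst))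
    (h : w.map (Prod.map u id) = w'.map (Prod.map u' id)) (z i : ShortConf Q Γ)
    (hz : (z, i) ∈ labelling w) : ∃ z', (z', i) ∈ labelling w' ∧ u z.1 = u' z'.1 := by
  obtain ⟨⟨c', i'⟩, hc, he⟩ := PMF.exists_of_map_eq h (c := (z.1, i)) hz
  obtain ⟨h1, rfl⟩ := Prod.ext_iff.1 he
  exact ⟨⟨c', fst_short hw' hc⟩, hc, h1.symm⟩

theorem simulation_matches_distType {n m : ℕ}
    (ih : ∀ c c', Δ.plts.approx n c c' ↔ Δ.Simulation.plts.approx m (embed A c) (embed A c'))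
    (q r : Q) {e e' : PMF (Q × List Γ)} (he : IsShort e) (he' : IsShort e') (β δ : List Γ)
    (h : PLTS.REquiv (Δ.plts.approx n) (e.map (app β)) (e'.map (app δ))) :
    Δ.Simulation.plts.Matches (m + 1) (q, .inr (.inl (Δ.distType e)) :: β.map .inl)
      (r, .inr (.inl (Δ.distType e')) :: δ.map .inl) := by
  rw [PLTS.rEquiv_approx_iff, PMF.map_comp, PMF.map_comp] at h
  simp only [PLTS.Matches, simulation_tr_distType]
  rintro _ _ ⟨S, τ, rfl, ⟨w, rfl, rfl, rfl⟩, rfl⟩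
  obtain ⟨w', rfl, hw⟩ := PMF.exists_transfer _ _ _ _ h
  have hsnd : w'.map Prod.snd = w.map Prod.snd := by
    have := congrArg (PMF.map Prod.snd) hw
    rw [PMF.map_comp, PMF.map_comp] at this
    exact this.symm
  refine ⟨_, ⟨labelling w', _, rfl, ⟨w', rfl, rfl, by rw [hsnd]⟩, rfl⟩, ?_⟩
  rw [PLTS.rEquiv_approx_pure_iff, PLTS.approx_succ_iff, simulation_matches_labelling_iff ih,
    simulation_matches_labelling_iff ih]
  constructor
  · intro z i hz
    obtain ⟨z', hz', h⟩ := labelling_transfer he' hw z i hz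
    exact ⟨z', hz', (PLTS.approxClass_eq_iff _ _ _ _).1 h⟩
  · intro z i hz
    obtain ⟨z', hz', h⟩ := labelling_transfer he hw.symm z i hz
    exact ⟨z', hz', (PLTS.approxClass_eq_iff _ _ _ _).1 h⟩

/-- A right-hand side representing a given class. -/
def representative {V : Type} (z₀ : ShortConf Q Γ) (u : Q × List Γ → V) (v : V) :
    ShortConf Q Γ :=
  open Classical in if h : ∃ z : ShortConf Q Γ, u z.1 = v then h.choose else z₀

theorem representative_spec {V : Type} (z₀ : ShortConf Q Γ) (u : Q × List Γ → V)
    (c : Q × List Γ) (hc : c.2.length ≤ 2) : u (representative z₀ u (u c)).1 = u c := by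
  have h : ∃ z : ShortConf Q Γ, u z.1 = u c := ⟨⟨c, hc⟩, rfl⟩
  rw [representative, dif_pos h]
  exact h.choose_spec

/-- If the simulating PDA cannot distinguish the types of `e` and of some rule
distribution of `rY`, then `rY` has a rule distribution equivalent to `e`. -/
theorem exists_rEquiv_of_simulation_matches {n m : ℕ} (hwf : PPDAWf Δ)
    (ih : ∀ c c', Δ.plts.approx n c c' ↔ Δ.Simulation.plts.approx m (embed A c) (embed A c'))
    (q r : Q) (Y : Γ) (a : A) {e e' : PMF (Q × List Γ)} (he : IsShort e) (he' : Δ r Y a e')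
    (β δ : List Γ)
    (h : Δ.Simulation.plts.Matches (m + 1) (q, .inr (.inl (Δ.distType e)) :: β.map .inl)
      (r, .inr (.inl (Δ.distType e')) :: δ.map .inl)) :
    ∃ e'', Δ r Y a e'' ∧
      PLTS.REquiv (Δ.plts.approx n) (e.map (app β)) (e''.map (app δ)) := by
  set u : Q × List Γ → _ := Δ.plts.approxClass n ∘ app β
  set u' : Q × List Γ → _ := Δ.plts.approxClass n ∘ app δ
  let rep := representative (⟨(q, []), by simp⟩ : ShortConf Q Γ) u
  let w := e.map fun c => (c, rep (u c))
  have hfst : w.map Prod.fst = e := by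
    rw [PMF.map_comp]
    exact PMF.map_id e
  have hw {c i} (hc : w (c, i) ≠ 0) : u i.1 = u c := by
    have : (c, i) ∈ w.support := hc
    rw [PMF.support_map] at this
    obtain ⟨c', hc', h⟩ := this
    obtain ⟨rfl, rfl⟩ := Prod.ext_iff.1 h
    exact representative_spec _ u c' (he c' hc')
  simp only [PLTS.Matches, simulation_tr_distType] at h
  obtain ⟨-, ⟨S', τ, hτ, ⟨w', rfl, rfl, hw'⟩, rfl⟩, hr⟩ :=
    h _ _ ⟨labelling w, _, rfl, ⟨w, hfst, rfl, rfl⟩, rfl⟩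
  obtain rfl : Δ.labelType (w.map Prod.snd) = τ := Sum.inl.inj (Sum.inr.inj hτ)
  rw [PLTS.rEquiv_approx_pure_iff, PLTS.approx_succ_iff, simulation_matches_labelling_iff ih,
    simulation_matches_labelling_iff ih] at hr
  have hmem : (r, Y, a, labelling w') ∈ Δ.labelType (w.map Prod.snd) := by
    have hw' : Δ.labelType (w'.map Prod.snd) = Δ.labelType (w.map Prod.snd) := hw'
    rw [← hw']
    exact ⟨w', he', rfl, rfl⟩
  obtain ⟨w'', he'', hS, hsnd⟩ := hmem
  have hS : labelling w'' = labelling w' := hS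
  refine ⟨w''.map Prod.fst, he'', ?_⟩
  rw [PLTS.rEquiv_approx_iff, PMF.map_comp, PMF.map_comp]
  symm
  calc (w''.map Prod.fst).map u' = w''.map fun p => u p.2.1 := by
        rw [PMF.map_comp]
        refine PMF.map_congr_support _ fun ⟨c, i⟩ hc => ?_
        have hlen := fst_short (fun c hc => hwf _ _ _ _ he'' _ _ hc) hc
        have hci : ((⟨c, hlen⟩, i) : ShortConf Q Γ × ShortConf Q Γ) ∈ labelling w' := by
          rw [← hS]
          exact hc
        obtain ⟨z, hz, hz'⟩ := hr.2 _ _ hci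
        exact ((PLTS.approxClass_eq_iff _ _ _ _).2 hz').trans (hw hz).symm
    _ = (w''.map Prod.snd).map fun i => u i.1 := by rw [PMF.map_comp]; rfl
    _ = e.map fun c => u (rep (u c)).1 := by
        rw [show w''.map Prod.snd = _ from hsnd, PMF.map_comp, PMF.map_comp]; rfl
    _ = e.map u := PMF.map_congr_support _ fun c hc => representative_spec _ u c (he c hc)

theorem matches_iff_simulation_matches {n m : ℕ} (hwf : PPDAWf Δ)
    (ih : ∀ c c', Δ.plts.approx n c c' ↔ Δ.Simulation.plts.approx m (embed A c) (embed A c'))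
    (c c' : Q × List Γ) :
    Δ.plts.Matches n c c' ↔
      Δ.Simulation.plts.Matches (m + 2) (embed A c) (embed A c') := by
  obtain ⟨q, _ | ⟨X, β⟩⟩ := c
  · exact ⟨fun _ _ _ h => (plts_tr_nil h).elim, fun _ _ _ h => (plts_tr_nil h).elim⟩
  obtain ⟨r, _ | ⟨Y, δ⟩⟩ := c'
  · constructor
    · intro h _ _ ht
      obtain ⟨b, e, rfl, he, rfl⟩ := Δ.simulation_tr_conf.1 ht
      obtain ⟨_, h, -⟩ := h b _ (plts_tr_cons.2 ⟨e, he, rfl⟩)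
      exact (plts_tr_nil h).elim
    · intro h b _ ht
      obtain ⟨e, he, rfl⟩ := plts_tr_cons.1 ht
      obtain ⟨_, h, -⟩ := h _ _ (Δ.simulation_tr_conf.2 ⟨b, e, rfl, he, rfl⟩)
      exact (plts_tr_nil h).elim
  have short {q X a e} (he : Δ q X a e) : IsShort e := fun c hc => hwf _ _ _ _ he _ _ hc
  constructor
  · intro h _ _ ht
    obtain ⟨b, e, rfl, he, rfl⟩ := Δ.simulation_tr_conf.1 ht
    obtain ⟨_, h, hr⟩ := h b _ (plts_tr_cons.2 ⟨e, he, rfl⟩)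
    obtain ⟨e', he', rfl⟩ := plts_tr_cons.1 h
    refine ⟨_, Δ.simulation_tr_conf.2 ⟨b, e', rfl, he', rfl⟩, ?_⟩
    rw [PLTS.rEquiv_approx_pure_iff, PLTS.approx_succ_iff]
    exact ⟨simulation_matches_distType ih _ _ (short he) (short he') _ _ hr,
      simulation_matches_distType ih _ _ (short he') (short he) _ _ fun s => (hr s).symm⟩
  · intro h b _ ht
    obtain ⟨e, he, rfl⟩ := plts_tr_cons.1 ht
    obtain ⟨_, h, hr⟩ := h _ _ (Δ.simulation_tr_conf.2 ⟨b, e, rfl, he, rfl⟩)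
    obtain ⟨b', e', hb, he', rfl⟩ := Δ.simulation_tr_conf.1 h
    obtain rfl : b = b' := by simpa using hb
    rw [PLTS.rEquiv_approx_pure_iff, PLTS.approx_succ_iff] at hr
    obtain ⟨e'', he'', hr⟩ :=
      exists_rEquiv_of_simulation_matches hwf ih _ _ _ _ (short he) he' _ _ hr.1
    exact ⟨_, plts_tr_cons.2 ⟨e'', he'', rfl⟩, hr⟩

theorem approx_iff_simulation_approx (hwf : PPDAWf Δ) (n : ℕ) (c c' : Q × List Γ) :
    Δ.plts.approx n c c' ↔ Δ.Simulation.plts.approx (3 * n) (embed A c) (embed A c') := by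
  induction n generalizing c c' with
  | zero => exact Iff.rfl
  | succ n ih =>
    rw [show 3 * (n + 1) = 3 * n + 2 + 1 by ring, PLTS.approx_succ_iff, PLTS.approx_succ_iff,
      matches_iff_simulation_matches hwf ih, matches_iff_simulation_matches hwf ih]

end PPDARules

/-- For every pPDA `Δ = (Q, Γ, A, ↪)` there is a
(nondeterministic) PDA `Δ' = (Q, Γ', A', ↪')` with `Γ ⊆ Γ'` (via `ιΓ`) and
`A ⊆ A'` (via `ιA`) such that for all `n` and all configurations `qXγ`, `rYδ`
of `Δ` with nonempty stack: `qXγ ∼ₙ rYδ` in `S(Δ)` iff `qXγ ∼_{3n} rYδ` in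
`S(Δ')`. -/
theorem ppda_to_pda_approx (Q Γ A : Type) [Fintype Q] [Fintype Γ] [Fintype A]
    (Δ : PPDARules Q Γ A) (hwf : PPDAWf Δ) :
    ∃ (Γ' A' : Type) (_ : Fintype Γ') (_ : Fintype A')
      (ιΓ : Γ ↪ Γ') (ιA : A ↪ A') (Δ' : PPDARules Q Γ' A'),
      IsPDA Δ' ∧ PPDAWf Δ' ∧
      ∀ (n : ℕ) (q r : Q) (X Y : Γ) (γ δ : List Γ),
        Δ.plts.approx n (q, X :: γ) (r, Y :: δ) ↔
          Δ'.plts.approx (3 * n) (q, ιΓ X :: γ.map ιΓ) (r, ιΓ Y :: δ.map ιΓ) := by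
  exact ⟨PPDARules.StackSym Q Γ A, PPDARules.InputSym Q Γ A, Fintype.ofFinite _,
    Fintype.ofFinite _, .inl, .inl, Δ.Simulation, Δ.isPDA_simulation, Δ.wf_simulation,
    fun n _ _ _ _ _ _ => PPDARules.approx_iff_simulation_approx hwf n _ _⟩
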